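/- arXiv:1603.07280 — 2 statements merged into one kernel-verified Lean document; each statement's English description precedes it below -/
import Mathlib

section
/- Let q = q*(k,σ) and λ = μ*(k,σ) := binom(n,k)·((n+σ)/n)·(n-2k)^k/(k+1)^{k+1}. Then the radial problem (P_λ) has a unique classical radial solution, given explicitly by u*(r) = 1 - ((1+k)/(1 + k r^{(2k+σ)/k}))^{(n-2k)/(2k+σ)} for r ∈ [0,1]. -/
open Real Set Filter MeasureTheory

noncomputable section

/-- `c_{n,k} = (1/n) * binom(n,k)`. -/
def cnk (n k : ℕ) : ℝ := (n.choose k : ℝ) / n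

/-- The critical exponent `q*(k,σ) = ((n+2)k + σ(k+1))/(n-2k)`. -/
def qstar (n k : ℕ) (σ : ℝ) : ℝ :=
  (((n : ℝ) + 2) * k + σ * ((k : ℝ) + 1)) / ((n : ℝ) - 2 * k)

/-- The Joseph–Lundgren type exponent `q_JL(k,σ)` (finite formula, valid
for `n > 2k + 8 + 4σ/k`). -/
def qJL (n k : ℕ) (σ : ℝ) : ℝ :=
  (k : ℝ) *
    (((k : ℝ) * ((k : ℝ) + 1) * n - (k : ℝ) ^ 2 * (2 - σ) + 2 * k + σ -
        2 * Real.sqrt ((k : ℝ) * (2 * k + σ) * (((k : ℝ) + 1) * n - (k : ℝ) * (2 - σ)))) /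
      ((k : ℝ) * ((k : ℝ) + 1) * n - 2 * (k : ℝ) ^ 2 * ((k : ℝ) + 3) - 2 * k * σ -
        2 * Real.sqrt ((k : ℝ) * (2 * k + σ) * (((k : ℝ) + 1) * n - (k : ℝ) * (2 - σ)))))

/-- `λ̃(k,σ) = c_{n,k} τ_σ^k (n - 2k - k τ_σ)` with `τ_σ = (2k+σ)/(q-k)`. -/
def lamTilde (n k : ℕ) (q σ : ℝ) : ℝ :=
  cnk n k * ((2 * (k : ℝ) + σ) / (q - k)) ^ k *
    ((n : ℝ) - 2 * k - (k : ℝ) * ((2 * (k : ℝ) + σ) / (q - k)))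

/-- `μ*(k,σ) = binom(n,k) ((n+σ)/n) (n-2k)^k / (k+1)^{k+1}`. -/
def muStar (n k : ℕ) (σ : ℝ) : ℝ :=
  (n.choose k : ℝ) * (((n : ℝ) + σ) / n) * ((n : ℝ) - 2 * k) ^ k / ((k : ℝ) + 1) ^ (k + 1)

/-- A classical radial solution of problem `(P_λ)`:
`u ∈ C²((0,1)) ∩ C¹([0,1])`, `u'(0) = 0`, `u(1) = 0`, `u < 0` on `(0,1)`,
`(r^{n-i} (u')^i)' ≥ 0` on `(0,1)` for `i = 1,…,k`, and
`c_{n,k} r^{1-n} (r^{n-k}(u')^k)' = λ r^σ (1-u)^q` on `(0,1)`. -/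
def IsRadialSol (n k : ℕ) (q σ lam : ℝ) (u : ℝ → ℝ) : Prop :=
  ContDiffOn ℝ 2 u (Ioo 0 1) ∧ ContDiffOn ℝ 1 u (Icc 0 1) ∧
  deriv u 0 = 0 ∧ u 1 = 0 ∧
  (∀ r ∈ Ioo (0:ℝ) 1, u r < 0) ∧
  (∀ i : ℕ, 1 ≤ i → i ≤ k →
    ∀ r ∈ Ioo (0:ℝ) 1, 0 ≤ deriv (fun s => s ^ ((n : ℝ) - i) * (deriv u s) ^ i) r) ∧
  (∀ r ∈ Ioo (0:ℝ) 1,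
    cnk n k * r ^ (1 - (n : ℝ)) *
        deriv (fun s => s ^ ((n : ℝ) - k) * (deriv u s) ^ k) r =
      lam * r ^ σ * (1 - u r) ^ q)

/-- A radial subsolution of `(P_λ)`. -/
def IsRadialSubsol (n k : ℕ) (q σ lam : ℝ) (u : ℝ → ℝ) : Prop :=
  ContDiffOn ℝ 2 u (Ioo 0 1) ∧ ContDiffOn ℝ 1 u (Icc 0 1) ∧
  (∀ i : ℕ, 1 ≤ i → i ≤ k →
    ∀ r ∈ Ioo (0:ℝ) 1, 0 ≤ deriv (fun s => s ^ ((n : ℝ) - i) * (deriv u s) ^ i) r) ∧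
  (∀ r ∈ Ioo (0:ℝ) 1,
    lam * r ^ σ * (1 - u r) ^ q ≤
      cnk n k * r ^ (1 - (n : ℝ)) *
        deriv (fun s => s ^ ((n : ℝ) - k) * (deriv u s) ^ k) r) ∧
  u 1 ≤ 0


section Aux

variable {n k : ℕ} {σ : ℝ}

lemma star_eq (n k : ℕ) (σ : ℝ) :
    (fun r : ℝ => 1 - ((1 + (k : ℝ)) / (1 + (k : ℝ) * r ^ ((2 * (k : ℝ) + σ) / k))) ^
        (((n : ℝ) - 2 * k) / (2 * (k : ℝ) + σ))) =
    fun r : ℝ => 1 - ((1 + (k : ℝ) * r ^ ((2 * (k : ℝ) + σ) / k)) / (1 + (k : ℝ))) ^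
        (-(((n : ℝ) - 2 * k) / (2 * (k : ℝ) + σ))) := by
  funext r
  rw [Real.rpow_neg_eq_inv_rpow, inv_div]

lemma zz_pos (k : ℕ) (a : ℝ) {r : ℝ} (hr : 0 ≤ r) :
    0 < (1 + (k : ℝ) * r ^ a) / (1 + (k : ℝ)) := by
  have := Real.rpow_nonneg hr a
  positivity

lemma zz_deriv (k : ℕ) {a : ℝ} (ha : 1 ≤ a) (r : ℝ) :
    HasDerivAt (fun r : ℝ => (1 + (k : ℝ) * r ^ a) / (1 + (k : ℝ)))
      ((k : ℝ) * (a * r ^ (a - 1)) / (1 + (k : ℝ))) r := by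
  have h := Real.hasDerivAt_rpow_const (x := r) (p := a) (Or.inr ha)
  exact ((h.const_mul (k : ℝ)).const_add 1).div_const _

lemma star_deriv (hk : 1 ≤ k) (hσ : 0 ≤ σ) {r : ℝ} (hr : 0 ≤ r) :
    HasDerivAt (fun r : ℝ => 1 - ((1 + (k : ℝ) * r ^ ((2 * (k : ℝ) + σ) / k)) / (1 + (k : ℝ))) ^
        (-(((n : ℝ) - 2 * k) / (2 * (k : ℝ) + σ))))
      (((n : ℝ) - 2 * k) / (k + 1) * r ^ ((2 * (k : ℝ) + σ) / k - 1) *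
        ((1 + (k : ℝ) * r ^ ((2 * (k : ℝ) + σ) / k)) / (1 + (k : ℝ))) ^
        (-((((n : ℝ) - 2 * k) / (2 * (k : ℝ) + σ)) + 1))) r := by
  have hk' : (0:ℝ) < k := by exact_mod_cast hk
  have ha : 1 ≤ (2 * (k : ℝ) + σ) / k := by
    rw [le_div_iff₀ hk']; linarith
  have h := ((zz_deriv k ha r).rpow_const
    (p := (-(((n : ℝ) - 2 * k) / (2 * (k : ℝ) + σ)))) (Or.inl (zz_pos k _ hr).ne')).const_sub 1
  refine h.congr_deriv ?_
  have e : -(((n : ℝ) - 2 * k) / (2 * (k : ℝ) + σ)) - 1 =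
    -((((n : ℝ) - 2 * k) / (2 * (k : ℝ) + σ)) + 1) := by ring
  rw [e]
  have h2 : (2 * (k : ℝ) + σ) ≠ 0 := by positivity
  field_simp
  ring

lemma star_P_deriv (hk : 1 ≤ k) (hσ : 0 ≤ σ) (i : ℕ) {r : ℝ} (hr : 0 < r) :
    HasDerivAt (fun s : ℝ => s ^ ((n : ℝ) - i) *
      (((n : ℝ) - 2 * k) / (k + 1) * s ^ ((2 * (k : ℝ) + σ) / k - 1) *
        ((1 + (k : ℝ) * s ^ ((2 * (k : ℝ) + σ) / k)) / (1 + (k : ℝ))) ^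
        (-((((n : ℝ) - 2 * k) / (2 * (k : ℝ) + σ)) + 1))) ^ i)
      ((((n : ℝ) - 2 * k) / (k + 1)) ^ i *
        r ^ ((n : ℝ) - i + i * ((2 * (k : ℝ) + σ) / k - 1) - 1) *
        ((1 + (k : ℝ) * r ^ ((2 * (k : ℝ) + σ) / k)) / (1 + (k : ℝ))) ^
        (-(i * (((n : ℝ) - 2 * k) / (2 * (k : ℝ) + σ) + 1)) - 1) *
        (1 / (1 + k) * (((n : ℝ) - i + i * ((2 * (k : ℝ) + σ) / k - 1)) +
          k * r ^ ((2 * (k : ℝ) + σ) / k) * (n * (1 - i / k))))) r := by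
  have hk' : (0:ℝ) < k := by exact_mod_cast hk
  have ha : 1 ≤ (2 * (k : ℝ) + σ) / k := by
    rw [le_div_iff₀ hk']; linarith
  have h2 : (2 * (k : ℝ) + σ) ≠ 0 := by positivity
  have key : (fun s : ℝ => s ^ ((n : ℝ) - i) *
      (((n : ℝ) - 2 * k) / (k + 1) * s ^ ((2 * (k : ℝ) + σ) / k - 1) *
        ((1 + (k : ℝ) * s ^ ((2 * (k : ℝ) + σ) / k)) / (1 + (k : ℝ))) ^
        (-((((n : ℝ) - 2 * k) / (2 * (k : ℝ) + σ)) + 1))) ^ i) =ᶠ[nhds r]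
      fun s => (((n : ℝ) - 2 * k) / (k + 1)) ^ i *
        (s ^ ((n : ℝ) - i + i * ((2 * (k : ℝ) + σ) / k - 1)) *
        ((1 + (k : ℝ) * s ^ ((2 * (k : ℝ) + σ) / k)) / (1 + (k : ℝ))) ^
        (-(i * (((n : ℝ) - 2 * k) / (2 * (k : ℝ) + σ) + 1)))) := by
    filter_upwards [lt_mem_nhds hr] with s hs
    rw [mul_pow, mul_pow, ← Real.rpow_mul_natCast hs.le,
      ← Real.rpow_mul_natCast (zz_pos k _ hs.le).le, Real.rpow_add hs,
      mul_comm ((2 * (k : ℝ) + σ) / k - 1)]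
    rw [show -(((n : ℝ) - 2 * k) / (2 * (k : ℝ) + σ) + 1) * (i:ℝ) =
      -(i * (((n : ℝ) - 2 * k) / (2 * (k : ℝ) + σ) + 1)) by ring]
    ring
  refine HasDerivAt.congr_of_eventuallyEq ?_ key
  have hz := zz_pos k ((2 * (k : ℝ) + σ) / k) hr.le
  have hd := ((Real.hasDerivAt_rpow_const (x := r)
    (p := (n : ℝ) - i + i * ((2 * (k : ℝ) + σ) / k - 1)) (Or.inl hr.ne')).mul
    ((zz_deriv k ha r).rpow_const
    (p := (-(i * (((n : ℝ) - 2 * k) / (2 * (k : ℝ) + σ) + 1))))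
     (Or.inl hz.ne'))).const_mul
    ((((n : ℝ) - 2 * k) / (k + 1)) ^ i)
  refine hd.congr_deriv ?_
  set E := (n : ℝ) - i + i * ((2 * (k : ℝ) + σ) / k - 1) with hE
  set M := (-(i * (((n : ℝ) - 2 * k) / (2 * (k : ℝ) + σ) + 1))) with hM
  have e1 : r ^ E = r ^ (E - 1) * r := by
    rw [← Real.rpow_add_one hr.ne', sub_add_cancel]
  have e2 : ((1 + (k : ℝ) * r ^ ((2 * (k : ℝ) + σ) / k)) / (1 + (k : ℝ))) ^ M =
      ((1 + (k : ℝ) * r ^ ((2 * (k : ℝ) + σ) / k)) / (1 + (k : ℝ))) ^ (M - 1) *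
      ((1 + (k : ℝ) * r ^ ((2 * (k : ℝ) + σ) / k)) / (1 + (k : ℝ))) := by
    rw [← Real.rpow_add_one hz.ne', sub_add_cancel]
  have e3 : r ^ ((2 * (k : ℝ) + σ) / k) = r ^ ((2 * (k : ℝ) + σ) / k - 1) * r := by
    rw [← Real.rpow_add_one hr.ne', sub_add_cancel]
  rw [e1, e2]
  have e4 : M * ((2 * (k : ℝ) + σ) / k) = n * (1 - i / k) - E := by
    rw [hM, hE]; field_simp; ring
  generalize ((1 + (k : ℝ) * r ^ ((2 * (k : ℝ) + σ) / k)) / (1 + (k : ℝ))) ^ (M - 1) = Z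
  rw [e3]
  generalize r ^ ((2 * (k : ℝ) + σ) / k - 1) = T
  generalize r ^ (E - 1) = R
  generalize (((n : ℝ) - 2 * k) / (k + 1)) ^ i = C
  have e5 : n * (1 - (i:ℝ) / k) = M * ((2 * (k : ℝ) + σ) / k) + E := by linarith
  rw [e5]
  generalize (2 * (k : ℝ) + σ) / k = A
  clear_value E M
  field_simp
  ring

lemma star_isSol (hk : 1 ≤ k) (hn : 2 * k < n) (hσ : 0 ≤ σ) :
    IsRadialSol n k (qstar n k σ) σ (muStar n k σ)
      (fun r => 1 - ((1 + (k : ℝ)) / (1 + (k : ℝ) * r ^ ((2 * (k : ℝ) + σ) / k))) ^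
        (((n : ℝ) - 2 * k) / (2 * (k : ℝ) + σ))) := by
  rw [star_eq]
  have hk' : (0:ℝ) < k := by exact_mod_cast hk
  have hn' : 2 * (k:ℝ) < n := by exact_mod_cast hn
  have ha : 2 ≤ (2 * (k : ℝ) + σ) / k := by
    rw [le_div_iff₀ hk']; linarith
  have hγ : 0 < (((n : ℝ) - 2 * k) / (2 * (k : ℝ) + σ)) := by
    apply div_pos <;> linarith
  have h2 : (2 * (k : ℝ) + σ) ≠ 0 := by positivity
  have hD : ∀ r ∈ Ioo (0:ℝ) 1, ∀ i : ℕ, _ := fun r hr i =>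
    ((star_P_deriv (n := n) hk hσ i hr.1).congr_of_eventuallyEq
      (f₁ := fun s => s ^ ((n : ℝ) - i) * (deriv (fun r : ℝ => 1 - ((1 + (k : ℝ) * r ^ ((2 * (k : ℝ) + σ) / k)) / (1 + (k : ℝ))) ^
        (-(((n : ℝ) - 2 * k) / (2 * (k : ℝ) + σ)))) s) ^ i) (by
        filter_upwards [lt_mem_nhds hr.1] with s hs
        rw [(star_deriv (n := n) hk hσ hs.le).deriv])).deriv
  have hc2 : ContDiffOn ℝ 2 (fun r : ℝ => 1 - ((1 + (k : ℝ) * r ^ ((2 * (k : ℝ) + σ) / k)) / (1 + (k : ℝ))) ^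
        (-(((n : ℝ) - 2 * k) / (2 * (k : ℝ) + σ)))) (Icc 0 1) := by
    have h := Real.contDiff_rpow_const_of_le (n := 2) (p := (2 * (k : ℝ) + σ) / k) (by simpa using ha)
    refine contDiffOn_const.sub (ContDiffOn.rpow_const_of_ne ?_ ?_)
    · exact ((contDiff_const.add (contDiff_const.mul h)).div_const _).contDiffOn
    · intro x hx
      exact (zz_pos k _ hx.1).ne'
  refine ⟨hc2.mono Ioo_subset_Icc_self, hc2.of_le (by norm_num), ?_, ?_, ?_, ?_, ?_⟩
  · rw [(star_deriv (n := n) hk hσ le_rfl).deriv, Real.zero_rpow (by linarith)]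
    simp
  · have : (1 + (k:ℝ)) ≠ 0 := by positivity
    simp [div_self this]
  · intro r hr
    have h1 : r ^ ((2 * (k : ℝ) + σ) / k) < 1 := Real.rpow_lt_one hr.1.le hr.2 (by linarith)
    have : 1 < ((1 + (k : ℝ) * r ^ ((2 * (k : ℝ) + σ) / k)) / (1 + (k : ℝ))) ^
        (-(((n : ℝ) - 2 * k) / (2 * (k : ℝ) + σ))) := by
      apply Real.one_lt_rpow_of_pos_of_lt_one_of_neg (zz_pos k _ hr.1.le) _ (by linarith)
      rw [div_lt_one (by positivity)]
      nlinarith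
    linarith
  · intro i hi1 hik r hr
    rw [hD r hr i]
    have hik' : (i:ℝ) ≤ k := by exact_mod_cast hik
    have := Real.rpow_nonneg hr.1.le ((2 * (k : ℝ) + σ) / k)
    have h3 : 0 ≤ 1 - (i:ℝ) / k := by
      rw [sub_nonneg, div_le_one hk']; exact hik'
    have h4 : 0 ≤ ((n : ℝ) - i + i * ((2 * (k : ℝ) + σ) / k - 1)) := by
      have : 0 ≤ i * ((2 * (k : ℝ) + σ) / k - 1) := mul_nonneg (by positivity) (by linarith)
      linarith
    have h5 : 0 ≤ (n : ℝ) - 2 * k := by linarith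
    have h6 := (zz_pos k ((2 * (k : ℝ) + σ) / k) hr.1.le).le
    have h7 := hr.1.le
    positivity
  · intro r hr
    have hz := (zz_pos k ((2 * (k : ℝ) + σ) / k) hr.1.le)
    rw [hD r hr k]
    have e1 : (1:ℝ) - (1 - ((1 + (k : ℝ) * r ^ ((2 * (k : ℝ) + σ) / k)) / (1 + (k : ℝ))) ^
        (-(((n : ℝ) - 2 * k) / (2 * (k : ℝ) + σ)))) = ((1 + (k : ℝ) * r ^ ((2 * (k : ℝ) + σ) / k)) / (1 + (k : ℝ))) ^
        (-(((n : ℝ) - 2 * k) / (2 * (k : ℝ) + σ))) := by ring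
    rw [e1, ← Real.rpow_mul hz.le]
    have h5 : (n : ℝ) - 2 * k ≠ 0 := by linarith
    have e2 : -(((n : ℝ) - 2 * k) / (2 * (k : ℝ) + σ)) * qstar n k σ =
      (-(k * (((n : ℝ) - 2 * k) / (2 * (k : ℝ) + σ) + 1)) - 1) := by
      unfold qstar; field_simp; ring
    rw [e2]
    have e3 : (n : ℝ) - k + k * ((2 * (k : ℝ) + σ) / k - 1) = n + σ := by field_simp; ring
    rw [e3]
    have e4 : r ^ σ = r ^ (1 - (n:ℝ)) * r ^ ((n:ℝ) + σ - 1) := by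
      rw [← Real.rpow_add hr.1]; congr 1; ring
    rw [e4]
    unfold muStar cnk
    rw [div_self hk'.ne', div_pow, pow_succ]
    have : (n:ℝ) ≠ 0 := by linarith
    field_simp
    ring

end Aux

section Uniq

/-- a function on `(0,1)` with zero derivative is constant -/
lemma const_of_deriv {f : ℝ → ℝ} (h : ∀ r ∈ Ioo (0:ℝ) 1, HasDerivAt f 0 r) :
    ∀ x ∈ Ioo (0:ℝ) 1, ∀ y ∈ Ioo (0:ℝ) 1, f x = f y := by
  intro x hx y hy
  exact isOpen_Ioo.is_const_of_deriv_eq_zero isPreconnected_Ioo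
    (fun r hr => (h r hr).differentiableAt.differentiableWithinAt)
    (fun r hr => (h r hr).deriv) hx hy

/-- The maximum of `X^k (1-X)` is attained only at `k/(k+1)`. -/
lemma max_unique {k : ℕ} (hk : 1 ≤ k) {X : ℝ} (hX : 0 < X)
    (h : X ^ k * (1 - X) = (k : ℝ) ^ k / ((k : ℝ) + 1) ^ (k + 1)) :
    X = (k : ℝ) / (k + 1) := by
  have hk' : (0:ℝ) < k := by exact_mod_cast hk
  have h1 : 0 < 1 - X := by
    have : 0 < X ^ k * (1 - X) := by rw [h]; positivity
    exact pos_of_mul_pos_right this (by positivity)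
  by_contra hne
  -- set x = (k+1) X / k, strict Bernoulli for 1/x
  set x := (k + 1) * X / k with hx
  have hXx : X = k * x / (k + 1) := by rw [hx]; field_simp
  have hx0 : 0 < x := by positivity
  have hx1 : x ≠ 1 := by
    intro h'; apply hne; rw [hXx, h']; ring
  have h3 : x ^ k * (k + 1 - k * x) = 1 := by
    rw [hXx] at h
    have e : (1 - k * x / ((k:ℝ) + 1)) = (k + 1 - k * x) / (k + 1) := by field_simp
    rw [e, div_pow, mul_pow, pow_succ] at h
    field_simp at h
    linarith
  have hb := one_add_mul_self_lt_rpow_one_add (s := x⁻¹ - 1) (by have := inv_pos.2 hx0; linarith)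
    (by intro h'; apply hx1; rw [sub_eq_zero] at h'; simpa using h') (p := (k:ℝ) + 1) (by linarith)
  rw [add_sub_cancel, show ((k:ℝ) + 1) = ((k + 1 : ℕ) : ℝ) by push_cast; rfl,
    Real.rpow_natCast, inv_pow] at hb
  push_cast at hb
  have h4 : x ^ (k + 1) * (1 + (k + 1) * (x⁻¹ - 1)) < 1 := by
    have hp : 0 < x ^ (k+1) := by positivity
    have := mul_lt_mul_of_pos_left hb hp
    rwa [mul_inv_cancel₀ hp.ne'] at this
  have h5 : x ^ (k + 1) * (1 + (k + 1) * (x⁻¹ - 1)) = x ^ k * (k + 1 - k * x) := by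
    rw [pow_succ]; field_simp; ring
  linarith

lemma sol_unique {n k : ℕ} {σ : ℝ} (hk : 1 ≤ k) (hn : 2 * k < n) (hσ : 0 ≤ σ)
    {u : ℝ → ℝ} (hu : IsRadialSol n k (qstar n k σ) σ (muStar n k σ) u) :
    EqOn u (fun r : ℝ => 1 - ((1 + (k : ℝ) * r ^ ((2 * (k : ℝ) + σ) / k)) / (1 + (k : ℝ))) ^
        (-(((n : ℝ) - 2 * k) / (2 * (k : ℝ) + σ)))) (Ioo 0 1) := by
  obtain ⟨hC2, hC1, -, hu1, hneg, hmon, heq⟩ := hu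
  have hk' : (0:ℝ) < k := by exact_mod_cast hk
  have hn' : 2 * (k:ℝ) < n := by exact_mod_cast hn
  have hn0 : (0:ℝ) < n := by linarith
  have hd : (0:ℝ) < n - 2 * k := by linarith
  have h2 : (0:ℝ) < (2 * (k : ℝ) + σ) := by positivity
  obtain ⟨v, hv⟩ : ∃ v, v = deriv u := ⟨_, rfl⟩
  rw [← hv] at hmon heq
  set q := qstar n k σ with hq
  have hq0 : 0 < q := by rw [hq]; unfold qstar; positivity
  -- basic regularity
  have hud : ∀ r ∈ Ioo (0:ℝ) 1, HasDerivAt u (v r) r := by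
    intro r hr
    rw [hv]
    exact ((hC2.contDiffAt (isOpen_Ioo.mem_nhds hr)).differentiableAt (by norm_num)).hasDerivAt
  have hvd : ∀ r ∈ Ioo (0:ℝ) 1, DifferentiableAt ℝ v r := by
    intro r hr
    have h := (contDiffOn_succ_iff_deriv_of_isOpen (n := 1) (𝕜 := ℝ) (f := u) isOpen_Ioo).1
      (by simpa [one_add_one_eq_two] using hC2)
    rw [hv]
    exact (h.2.2.contDiffAt (isOpen_Ioo.mem_nhds hr)).differentiableAt (by norm_num)
  obtain ⟨B, hB⟩ : ∃ B, ∀ r ∈ Ioo (0:ℝ) 1, |v r| ≤ B := by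
    have h := hC1.continuousOn_derivWithin (uniqueDiffOn_Icc zero_lt_one) le_rfl
    obtain ⟨B, hB⟩ := isCompact_Icc.exists_bound_of_continuousOn h
    refine ⟨B, fun r hr => ?_⟩
    have := hB r (Ioo_subset_Icc_self hr)
    rwa [derivWithin_of_mem_nhds (Icc_mem_nhds hr.1 hr.2), ← hv] at this
  have hw : ∀ r ∈ Ioo (0:ℝ) 1, 0 < 1 - u r := fun r hr => by linarith [hneg r hr]
  have hF : (nhdsWithin (0:ℝ) (Ioo 0 1)).NeBot := by
    rw [nhdsWithin_Ioo_eq_nhdsGT zero_lt_one]; infer_instance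
  have hucont : ContinuousOn u (Icc 0 1) := hC1.continuousOn
  have hu0 : Tendsto u (nhdsWithin 0 (Ioo 0 1)) (nhds (u 0)) :=
    (hucont 0 (by simp)).mono_left (nhdsWithin_mono _ Ioo_subset_Icc_self)
  have hid0 : Tendsto (fun r : ℝ => r) (nhdsWithin 0 (Ioo 0 1)) (nhds 0) :=
    tendsto_id.mono_left nhdsWithin_le_nhds
  have hpow0 : ∀ e : ℝ, 0 < e → Tendsto (fun r : ℝ => r ^ e) (nhdsWithin 0 (Ioo 0 1)) (nhds 0) := by
    intro e he
    have := hid0.rpow_const (p := e) (Or.inr he.le)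
    rwa [Real.zero_rpow he.ne'] at this
  have hbdd : ∀ (i : ℕ) (e : ℝ), 0 < e →
      Tendsto (fun r : ℝ => r ^ e * v r ^ i) (nhdsWithin 0 (Ioo 0 1)) (nhds 0) := by
    intro i e he
    refine (hpow0 e he).zero_mul_isBoundedUnder_le ?_
    refine ⟨B ^ i, ?_⟩
    rw [eventually_map]
    filter_upwards [self_mem_nhdsWithin] with r hr
    simp only [Function.comp, norm_pow, Real.norm_eq_abs]
    exact pow_le_pow_left₀ (abs_nonneg _) (hB r hr) i
  -- v is nonnegative
  have hv0 : ∀ r ∈ Ioo (0:ℝ) 1, 0 ≤ v r := by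
    have hm : MonotoneOn (fun s : ℝ => s ^ ((n:ℝ) - (1:ℕ)) * v s ^ 1) (Ioo 0 1) := by
      have hdiff : ∀ r ∈ Ioo (0:ℝ) 1, DifferentiableAt ℝ
          (fun s : ℝ => s ^ ((n:ℝ) - (1:ℕ)) * v s ^ 1) r := fun r hr =>
        (Real.differentiableAt_rpow_const_of_ne _ hr.1.ne').mul ((hvd r hr).pow 1)
      refine monotoneOn_of_deriv_nonneg (convex_Ioo 0 1)
        (fun r hr => (hdiff r hr).continuousAt.continuousWithinAt)
        (fun r hr => (hdiff r (interior_subset hr)).differentiableWithinAt) ?_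
      intro r hr
      exact hmon 1 le_rfl hk r (interior_subset hr)
    have hlim := hbdd 1 ((n:ℝ) - (1:ℕ)) (by
      have : (1:ℝ) ≤ k := by exact_mod_cast hk
      push_cast; linarith)
    intro r hr
    have h0 : 0 ≤ r ^ ((n:ℝ) - (1:ℕ)) * v r ^ 1 := by
      refine le_of_tendsto hlim ?_
      filter_upwards [self_mem_nhdsWithin, nhdsWithin_le_nhds (gt_mem_nhds hr.1)] with s hs hsr
      exact hm hs hr (le_of_lt hsr)
    rw [pow_one] at h0
    exact nonneg_of_mul_nonneg_right h0 (Real.rpow_pos_of_pos hr.1 _)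
  -- the equation
  obtain ⟨K, hK⟩ : ∃ K : ℝ, K = ((n:ℝ) - 2 * k) ^ k / ((k:ℝ) + 1) ^ (k + 1) := ⟨_, rfl⟩
  have hK0 : 0 < K := by rw [hK]; positivity
  obtain ⟨P, hP⟩ : ∃ P : ℝ → ℝ, P = fun s => s ^ ((n : ℝ) - k) * v s ^ k := ⟨_, rfl⟩
  have hPr : ∀ r, P r = r ^ ((n : ℝ) - k) * v r ^ k := fun r => by rw [hP]
  have hPdiff : ∀ r ∈ Ioo (0:ℝ) 1, DifferentiableAt ℝ P r := by
    intro r hr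
    rw [hP]
    exact (Real.differentiableAt_rpow_const_of_ne _ hr.1.ne').mul ((hvd r hr).pow k)
  have hPd : ∀ r ∈ Ioo (0:ℝ) 1,
      HasDerivAt P (K * (n + σ) * r ^ ((n:ℝ) + σ - 1) * (1 - u r) ^ q) r := by
    intro r hr
    have h := heq r hr
    rw [← hP] at h
    refine (hPdiff r hr).hasDerivAt.congr_deriv ?_
    have e4 : r ^ σ = r ^ (1 - (n:ℝ)) * r ^ ((n:ℝ) + σ - 1) := by
      rw [← Real.rpow_add hr.1]; congr 1; ring
    rw [e4] at h
    have hR : r ^ (1 - (n:ℝ)) ≠ 0 := (Real.rpow_pos_of_pos hr.1 _).ne'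
    have hch : (n.choose k : ℝ) ≠ 0 := by
      have := Nat.choose_pos (n := n) (k := k) (by omega)
      positivity
    unfold muStar cnk at h
    rw [hK]
    have hcc : (n.choose k : ℝ) / n * r ^ (1 - (n:ℝ)) ≠ 0 :=
      mul_ne_zero (div_ne_zero hch hn0.ne') hR
    apply mul_left_cancel₀ hcc
    rw [h]
    field_simp
  -- second expression for the derivative of P
  have hPd2 : ∀ r ∈ Ioo (0:ℝ) 1,
      r * v r * (K * (n + σ) * r ^ ((n:ℝ) + σ - 1) * (1 - u r) ^ q) =
        (n - k) * P r * v r + k * P r * (r * deriv v r) := by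
    intro r hr
    have h1 : HasDerivAt P (((n:ℝ) - k) * r ^ ((n:ℝ) - k - 1) * v r ^ k +
        r ^ ((n:ℝ) - k) * (k * v r ^ (k - 1) * deriv v r)) r := by
      rw [hP]
      exact (Real.hasDerivAt_rpow_const (x := r)
        (p := (n : ℝ) - k) (Or.inl hr.1.ne')).mul ((hvd r hr).hasDerivAt.pow k)
    rw [(hPd r hr).unique h1, hPr]
    have e1 : r ^ ((n : ℝ) - k) = r ^ ((n : ℝ) - k - 1) * r := by
      rw [← Real.rpow_add_one hr.1.ne', sub_add_cancel]
    have e2 : v r ^ k = v r ^ (k - 1) * v r := by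
      rw [← pow_succ, Nat.sub_add_cancel hk]
    rw [e1, e2]; ring
  -- Pohozaev
  have hE : ∀ r ∈ Ioo (0:ℝ) 1,
      P r * ((1 - u r) - k / (n - 2 * k) * (r * v r)) - K * (r ^ ((n:ℝ) + σ) * (1 - u r) ^ (q + 1)) = 0 := by
    set E : ℝ → ℝ := fun r => P r * ((1 - u r) - k / (n - 2 * k) * (r * v r)) -
      K * (r ^ ((n:ℝ) + σ) * (1 - u r) ^ (q + 1)) with hEdef
    have hEd : ∀ r ∈ Ioo (0:ℝ) 1, HasDerivAt E 0 r := by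
      intro r hr
      have hwd := (hud r hr).const_sub 1
      have h := ((hPd r hr).mul (hwd.sub (((hasDerivAt_id r).mul
        (hvd r hr).hasDerivAt).const_mul ((k:ℝ) / (n - 2 * k))))).sub
        (((Real.hasDerivAt_rpow_const (x := r) (p := (n:ℝ) + σ) (Or.inl hr.1.ne')).mul
          (hwd.rpow_const (p := q + 1) (Or.inl (hw r hr).ne'))).const_mul K)
      refine h.congr_deriv ?_
      have h3 := hPd2 r hr
      have e1 : r ^ ((n:ℝ) + σ) = r ^ ((n:ℝ) + σ - 1) * r := by
        rw [← Real.rpow_add_one hr.1.ne', sub_add_cancel]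
      have e2 : (1 - u r) ^ (q + 1) = (1 - u r) ^ q * (1 - u r) := by
        rw [← Real.rpow_add_one (hw r hr).ne']
      have e3 : q + 1 = (k + 1) * (n + σ) / (n - 2 * k) := by
        rw [hq]; unfold qstar; field_simp; ring
      rw [add_sub_cancel_right, e1, e2, e3]
      simp only [id, Pi.mul_apply, Pi.sub_apply]
      generalize r ^ ((n:ℝ) + σ - 1) = R at *
      generalize (1 - u r) ^ q = W at *
      generalize deriv v r = v' at *
      have hkd : (k:ℝ) * (n - 2 * k) ≠ 0 := by positivity
      field_simp
      have hi : ((n:ℝ) - 2 * k) * ((n:ℝ) - 2 * k)⁻¹ = 1 := mul_inv_cancel₀ hd.ne'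
      linear_combination ((n:ℝ) - 2 * k)⁻¹ * h3 + P r * v r * hi
    have hc := const_of_deriv hEd
    have hlim : Tendsto E (nhdsWithin 0 (Ioo 0 1)) (nhds 0) := by
      have hP0 := hbdd k ((n:ℝ) - k) (by linarith)
      have hrv := hbdd 1 1 one_pos
      simp only [Real.rpow_one, pow_one] at hrv
      have hw0 : Tendsto (fun r => 1 - u r) (nhdsWithin 0 (Ioo 0 1)) (nhds (1 - u 0)) :=
        hu0.const_sub 1
      have h := (hP0.mul (hw0.sub (hrv.const_mul ((k:ℝ) / (n - 2 * k))))).sub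
        (((hpow0 ((n:ℝ) + σ) (by linarith)).mul
          (hw0.rpow_const (p := q + 1) (Or.inr (by linarith)))).const_mul K)
      simp only [zero_mul, mul_zero, sub_zero] at h
      rw [hEdef, hP]
      exact h
    intro r hr
    have : Tendsto E (nhdsWithin 0 (Ioo 0 1)) (nhds (E r)) := by
      refine tendsto_const_nhds.congr' ?_
      filter_upwards [self_mem_nhdsWithin] with s hs
      exact hc r hr s hs
    exact tendsto_nhds_unique this hlim
  have hPpos : ∀ r ∈ Ioo (0:ℝ) 1, 0 < P r := by
    intro r hr
    have h0 : 0 ≤ P r := by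
      rw [hPr]; exact mul_nonneg (Real.rpow_nonneg hr.1.le _) (pow_nonneg (hv0 r hr) _)
    refine lt_of_le_of_ne h0 fun h => ?_
    have h1 := hE r hr
    rw [← h] at h1
    have h3 : 0 < K * (r ^ ((n:ℝ) + σ) * (1 - u r) ^ (q + 1)) :=
      mul_pos hK0 (mul_pos (Real.rpow_pos_of_pos hr.1 _) (Real.rpow_pos_of_pos (hw r hr) _))
    linarith
  have hvpos : ∀ r ∈ Ioo (0:ℝ) 1, 0 < v r := by
    intro r hr
    refine lt_of_le_of_ne (hv0 r hr) fun h => ?_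
    have := hPpos r hr
    rw [hPr, ← h, zero_pow (by omega)] at this
    simp at this
  -- G is constant
  obtain ⟨m, hm⟩ : ∃ m : ℝ, m = k * (n + σ) / (n - 2 * k) := ⟨_, rfl⟩
  have hGd : ∀ r ∈ Ioo (0:ℝ) 1, HasDerivAt
      (fun r => P r * (r ^ (-((n:ℝ) + σ)) * (1 - u r) ^ (-m))) 0 r := by
    intro r hr
    have hwd := (hud r hr).const_sub 1
    have h := (hPd r hr).mul ((Real.hasDerivAt_rpow_const (x := r) (p := -((n:ℝ) + σ))
      (Or.inl hr.1.ne')).mul (hwd.rpow_const (p := -m) (Or.inl (hw r hr).ne')))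
    refine h.congr_deriv ?_
    have h3 := hE r hr
    have e1 : r ^ ((n:ℝ) + σ) = r ^ ((n:ℝ) + σ - 1) * r := by
      rw [← Real.rpow_add_one hr.1.ne', sub_add_cancel]
    have e2 : (1 - u r) ^ (q + 1) = (1 - u r) ^ q * (1 - u r) := by
      rw [← Real.rpow_add_one (hw r hr).ne']
    have e3 : r ^ (-((n:ℝ) + σ)) = r ^ (-((n:ℝ) + σ) - 1) * r := by
      rw [← Real.rpow_add_one hr.1.ne', sub_add_cancel]
    have e4 : (1 - u r) ^ (-m) = (1 - u r) ^ (-m - 1) * (1 - u r) := by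
      rw [← Real.rpow_add_one (hw r hr).ne', sub_add_cancel]
    rw [e1, e2] at h3
    simp only [Pi.mul_apply]
    rw [e3, e4, hm]
    generalize (1 - u r) ^ (-(k * (n + σ) / (n - 2 * k)) - 1) = W1 at *
    generalize r ^ (-((n:ℝ) + σ) - 1) = R1 at *
    generalize r ^ ((n:ℝ) + σ - 1) = R at *
    generalize (1 - u r) ^ q = W at *
    field_simp at h3 ⊢
    linear_combination (-(n + σ) * R1 * W1 : ℝ) * h3
  have hGc := const_of_deriv hGd
  obtain ⟨a, ha⟩ : ∃ a : ℝ, a = (2 * (k : ℝ) + σ) / k := ⟨_, rfl⟩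
  obtain ⟨γ, hγ⟩ : ∃ γ : ℝ, γ = ((n : ℝ) - 2 * k) / (2 * (k : ℝ) + σ) := ⟨_, rfl⟩
  have hγ0 : 0 < γ := by rw [hγ]; positivity
  rw [← ha, ← hγ]
  have hhalf : (1/2:ℝ) ∈ Ioo (0:ℝ) 1 := by norm_num
  set G := P (1/2) * ((1/2) ^ (-((n:ℝ) + σ)) * (1 - u (1/2)) ^ (-m)) with hG
  have hG0 : 0 < G := mul_pos (hPpos _ hhalf) (mul_pos (by positivity) (Real.rpow_pos_of_pos (hw _ hhalf) _))
  obtain ⟨g, hg0, hgk⟩ : ∃ g : ℝ, 0 < g ∧ g ^ k = G :=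
    ⟨G ^ ((k:ℝ)⁻¹), Real.rpow_pos_of_pos hG0 _, Real.rpow_inv_natCast_pow hG0.le (by omega)⟩
  have hPG : ∀ r ∈ Ioo (0:ℝ) 1, P r = G * (r ^ ((n:ℝ) + σ) * (1 - u r) ^ m) := by
    intro r hr
    have hc := hGc r hr _ hhalf
    rw [← hG] at hc
    rw [← hc, Real.rpow_neg hr.1.le, Real.rpow_neg (hw r hr).le]
    have := (Real.rpow_pos_of_pos hr.1 ((n:ℝ) + σ)).ne'
    have := (Real.rpow_pos_of_pos (hw r hr) m).ne'
    field_simp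
  have hvg : ∀ r ∈ Ioo (0:ℝ) 1, r * v r = g * r ^ a * (1 - u r) ^ (1 + γ⁻¹) := by
    intro r hr
    have h0 := Real.rpow_pos_of_pos hr.1 a
    have h1 := Real.rpow_pos_of_pos (hw r hr) (1 + γ⁻¹)
    have hr0 := hr.1
    have hvr := hvpos r hr
    refine (pow_left_inj₀ (n := k) (by positivity) (by positivity) (by omega)).1 ?_
    have h3 := hPG r hr
    rw [hPr] at h3
    have hR := Real.rpow_pos_of_pos hr.1 ((n:ℝ) - k)
    rw [mul_pow, mul_pow, mul_pow, hgk, ← Real.rpow_mul_natCast hr.1.le,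
      ← Real.rpow_mul_natCast (hw r hr).le]
    have e1 : a * k = 2 * k + σ := by rw [ha]; field_simp
    have e2 : (1 + γ⁻¹) * k = m := by rw [hγ, hm]; field_simp; ring
    have e3 : r ^ ((n:ℝ) + σ) * r ^ k = r ^ ((n:ℝ) - k) * r ^ (2 * (k:ℝ) + σ) := by
      rw [← Real.rpow_natCast, ← Real.rpow_add hr.1, ← Real.rpow_add hr.1]
      congr 1; ring
    rw [e1, e2]
    apply mul_left_cancel₀ hR.ne'
    linear_combination r ^ k * h3 + G * (1 - u r) ^ m * e3
  have hz : ∀ r ∈ Ioo (0:ℝ) 1, (1 - u r) ^ (-γ⁻¹) = K / G + k / (n - 2 * k) * g * r ^ a := by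
    intro r hr
    have h1 := hE r hr
    have hw1 := Real.rpow_pos_of_pos (hw r hr) (1 + γ⁻¹)
    have hw2 := Real.rpow_pos_of_pos (hw r hr) m
    have hR := Real.rpow_pos_of_pos hr.1 ((n:ℝ) + σ)
    have e1 : (1 - u r) ^ (q + 1) = (1 - u r) ^ m * (1 - u r) ^ (1 + γ⁻¹) := by
      rw [← Real.rpow_add (hw r hr)]
      congr 1
      rw [hq, hm, hγ]; unfold qstar; field_simp; ring
    have e2 : (1 - u r) = (1 - u r) ^ (-γ⁻¹) * (1 - u r) ^ (1 + γ⁻¹) := by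
      rw [← Real.rpow_add (hw r hr)]
      ring_nf
      simp
    rw [hPG r hr, hvg r hr, e1] at h1
    have h3 : (1 - u r) - k / (n - 2 * k) * (g * r ^ a * (1 - u r) ^ (1 + γ⁻¹)) =
        K / G * (1 - u r) ^ (1 + γ⁻¹) := by
      have hc : G * (r ^ ((n:ℝ) + σ) * (1 - u r) ^ m) ≠ 0 := by positivity
      apply mul_left_cancel₀ hc
      have : G * (r ^ ((n:ℝ) + σ) * (1 - u r) ^ m) * (K / G * (1 - u r) ^ (1 + γ⁻¹)) =
        K * (r ^ ((n:ℝ) + σ) * ((1 - u r) ^ m * (1 - u r) ^ (1 + γ⁻¹))) := by field_simp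
      rw [this]; linarith
    apply mul_right_cancel₀ hw1.ne'
    rw [← e2]; linarith
  -- evaluate at 1
  have h1 : 1 = K / G + k / (n - 2 * k) * g := by
    have hF1 : (nhdsWithin (1:ℝ) (Ioo 0 1)).NeBot := by
      rw [nhdsWithin_Ioo_eq_nhdsLT zero_lt_one]; infer_instance
    have hu1' : Tendsto u (nhdsWithin 1 (Ioo 0 1)) (nhds 0) := by
      have := (hucont 1 (by simp)).mono_left (nhdsWithin_mono _ Ioo_subset_Icc_self)
      rwa [hu1] at this
    have hid1 : Tendsto (fun r : ℝ => r) (nhdsWithin 1 (Ioo 0 1)) (nhds 1) :=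
      tendsto_id.mono_left nhdsWithin_le_nhds
    have hL := (hu1'.const_sub 1).rpow_const (p := -γ⁻¹) (Or.inl (by norm_num))
    have hR := ((hid1.rpow_const (p := a) (Or.inl (by norm_num))).const_mul
      (k / (n - 2 * k) * g)).const_add (K / G)
    simp only [sub_zero, Real.one_rpow, mul_one] at hL hR
    refine tendsto_nhds_unique hL (hR.congr' ?_)
    filter_upwards [self_mem_nhdsWithin] with r hr
    exact (hz r hr).symm
  have hX : k / (n - 2 * k) * g = (k:ℝ) / (k + 1) := by
    apply max_unique hk (by positivity)
    rw [show 1 - k / (n - 2 * k) * g = K / G by linarith, mul_pow, hgk, hK, div_pow]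
    field_simp
  intro r hr
  have h3 := hz r hr
  rw [hX, show K / G = 1 / (k + 1) by rw [hX] at h1; field_simp at h1 ⊢; linarith] at h3
  have h4 : (1 + (k:ℝ) * r ^ a) / (1 + k) = (1 - u r) ^ (-γ⁻¹) := by
    rw [h3]; field_simp; ring
  simp only []
  rw [h4, ← Real.rpow_mul (hw r hr).le, neg_mul_neg, inv_mul_cancel₀ hγ0.ne', Real.rpow_one]
  ring

end Uniq

/-- for `q = q*(k,σ)` and `λ = μ*(k,σ)` problem `(P_λ)` has a unique classical
radial solution, given by the explicit formula
`u*(r) = 1 - ((1+k)/(1 + k r^{(2k+σ)/k}))^{(n-2k)/(2k+σ)}`. -/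
theorem unique_solution_at_muStar (n k : ℕ) (hk : 1 ≤ k) (hn : 2 * k < n)
    (σ : ℝ) (hσ : 0 ≤ σ) :
    IsRadialSol n k (qstar n k σ) σ (muStar n k σ)
      (fun r => 1 - ((1 + (k : ℝ)) / (1 + (k : ℝ) * r ^ ((2 * (k : ℝ) + σ) / k))) ^
        (((n : ℝ) - 2 * k) / (2 * (k : ℝ) + σ))) ∧
    ∀ u : ℝ → ℝ, IsRadialSol n k (qstar n k σ) σ (muStar n k σ) u →
      EqOn u
        (fun r => 1 - ((1 + (k : ℝ)) / (1 + (k : ℝ) * r ^ ((2 * (k : ℝ) + σ) / k))) ^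
          (((n : ℝ) - 2 * k) / (2 * (k : ℝ) + σ)))
        (Icc 0 1) := by
  have hs := star_isSol (n := n) (k := k) (σ := σ) hk hn hσ
  refine ⟨hs, fun u hu => ?_⟩
  have hEq := sol_unique hk hn hσ hu
  rw [← star_eq] at hEq
  refine hEq.of_subset_closure hu.2.1.continuousOn hs.2.1.continuousOn Ioo_subset_Icc_self ?_
  rw [closure_Ioo zero_ne_one]
end
end

section
/- Assume n > 2k + 8 + 4σ/k and q ≥ q_JL(k,σ). Let (x(t),y(t)) be a solution of the Lotka–Volterra system (LV) with x(t) > 0, y(t) > 0 for all t, lim_{t→-∞}(x(t),y(t)) = (n+σ, 0) and lim_{t→+∞}(x(t),y(t)) = (x̂,ŷ), where x̂ = (q(n-2k)-(n+σ)k)/(q-k) and ŷ = (2k+σ)/(q-k). Set a_σ = q(n-2k)-(n+σ)k, α = (2k+σ+a_σ)/(2a_σ), d = q^{-α}((2k+σ)/(q-k))^{1-α}, and g(x) = d(n+σ-x)^α for x ∈ [x̂, n+σ]. Then the orbit remains below the curve y = g(x): for all t with x(t) ∈ (x̂, n+σ) one has y(t) ≤ g(x(t)); in particular the orbit coincides with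 the graph of a monotone function y = y(x) and does not spiral around (x̂,ŷ). -/
open Real Set Filter MeasureTheory

noncomputable section

/-- `a_σ = q(n-2k) - (n+σ)k`. -/
def aSigma (n k : ℕ) (q σ : ℝ) : ℝ := q * ((n : ℝ) - 2 * k) - ((n : ℝ) + σ) * k

/-- `α = (2k+σ+a_σ)/(2a_σ)`. -/
def alphaExp (n k : ℕ) (q σ : ℝ) : ℝ :=
  (2 * (k : ℝ) + σ + aSigma n k q σ) / (2 * aSigma n k q σ)

/-- `g(x) = d (n+σ-x)^α` with `d = q^{-α}((2k+σ)/(q-k))^{1-α}`. -/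
def gFun (n k : ℕ) (q σ : ℝ) (x : ℝ) : ℝ :=
  q ^ (-(alphaExp n k q σ)) *
    ((2 * (k : ℝ) + σ) / (q - (k : ℝ))) ^ (1 - alphaExp n k q σ) *
    ((n : ℝ) + σ - x) ^ alphaExp n k q σ

lemma aux_deriv_nonpos {f : ℝ → ℝ} {d a c : ℝ} (hac : a < c) (hf : HasDerivAt f d c)
    (h : ∀ t, a ≤ t → t < c → 0 < f t) (hc : f c ≤ 0) : d ≤ 0 := by
  have h1 : Tendsto (slope f c) (nhdsWithin c (Iio c)) (nhds d) := by
    have := hasDerivWithinAt_iff_tendsto_slope.1 (hf.hasDerivWithinAt (s := Iio c))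
    simpa using this
  refine le_of_tendsto h1 ?_
  have : Ioo a c ∈ nhdsWithin c (Iio c) := Ioo_mem_nhdsLT hac
  filter_upwards [this] with t ht
  rw [slope_def_field]
  have := h t ht.1.le ht.2
  apply div_nonpos_of_nonneg_of_nonpos <;> linarith [ht.2]

lemma aux_deriv_nonneg {f : ℝ → ℝ} {d c b : ℝ} (hcb : c < b) (hf : HasDerivAt f d c)
    (h : ∀ t, c < t → t ≤ b → 0 < f t) (hc : f c ≤ 0) : 0 ≤ d := by
  have h1 : Tendsto (slope f c) (nhdsWithin c (Ioi c)) (nhds d) := by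
    have := hasDerivWithinAt_iff_tendsto_slope.1 (hf.hasDerivWithinAt (s := Ioi c))
    simpa using this
  refine ge_of_tendsto h1 ?_
  have : Ioo c b ∈ nhdsWithin c (Ioi c) := Ioo_mem_nhdsGT hcb
  filter_upwards [this] with t ht
  rw [slope_def_field]
  have := h t ht.1 ht.2.le
  apply div_nonneg <;> linarith [ht.1]

lemma aux_first {f : ℝ → ℝ} {a b : ℝ} (hf : Continuous f) (hab : a ≤ b) (ha : 0 < f a)
    (hb : f b ≤ 0) : ∃ c, a < c ∧ c ≤ b ∧ f c ≤ 0 ∧ ∀ t, a ≤ t → t < c → 0 < f t := by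
  let S := Icc a b ∩ f ⁻¹' (Iic 0)
  have hS : IsCompact S := isCompact_Icc.inter_right (isClosed_Iic.preimage hf)
  obtain ⟨c, hc, hmin⟩ := hS.exists_isLeast ⟨b, ⟨hab, le_rfl⟩, hb⟩
  have hfc : f c ≤ 0 := hc.2
  refine ⟨c, ?_, hc.1.2, hfc, ?_⟩
  · rcases hc.1.1.lt_or_eq with h | h
    · exact h
    · rw [← h] at hfc; linarith
  · intro t hat htc
    by_contra hcon
    have : c ≤ t := hmin ⟨⟨hat, htc.le.trans hc.1.2⟩, not_lt.1 hcon⟩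
    linarith

lemma aux_last {f : ℝ → ℝ} {a b : ℝ} (hf : Continuous f) (hab : a ≤ b) (hb : 0 < f b)
    (ha : f a ≤ 0) : ∃ c, a ≤ c ∧ c < b ∧ f c ≤ 0 ∧ ∀ t, c < t → t ≤ b → 0 < f t := by
  obtain ⟨c, h1, h2, h3, h4⟩ := aux_first (f := fun t => f (-t)) (a := -b) (b := -a)
    (by fun_prop) (by linarith) (by simpa using hb) (by simpa using ha)
  refine ⟨-c, by linarith, by linarith, h3, fun t ht1 ht2 => ?_⟩
  have := h4 (-t) (by linarith) (by linarith)
  simpa using this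

/-- the barrier inequality -/
lemma aux_barrier {q K yh xh α v : ℝ} (hK : 0 < K) (hqK : K < q) (hxh : 0 < xh) (hyh : 0 < yh)
    (hα1 : α < 1) (hα : yh = (2 * α - 1) * xh) (hJL : yh / K * q ≤ α ^ 2 * xh)
    (hv0 : 0 < v) (hv1 : v < 1) :
    yh / K * (q * (1 - v) - K * (1 - v ^ α))
      < α * ((xh + q * yh * (1 - v)) * (v ^ α / v - 1)) := by
  have hα0 : 1 / 2 < α := by
    by_contra h
    have : (2 * α - 1) * xh ≤ 0 := mul_nonpos_of_nonpos_of_nonneg (by linarith) hxh.le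
    linarith
  have hw : 0 < v ^ α := rpow_pos_of_pos hv0 _
  have hwv : v < v ^ α := by
    conv_lhs => rw [← rpow_one v]
    exact rpow_lt_rpow_of_exponent_gt hv0 hv1 hα1
  have hB : v ^ (1 - α) ≤ α + (1 - α) * v := by
    have := rpow_one_add_le_one_add_mul_self (s := v - 1) (by linarith) (p := 1 - α)
      (by linarith) (by linarith)
    have h2 : 1 + (v - 1) = v := by ring
    rw [h2] at this
    linarith
  have hprod : v ^ α * v ^ (1 - α) = v := by
    rw [← rpow_add hv0]; simp
  have hB2 : v ≤ v ^ α * (α + (1 - α) * v) := by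
    calc v = v ^ α * v ^ (1 - α) := hprod.symm
      _ ≤ _ := by gcongr
  generalize v ^ α = w at *
  have hmain : v * (α ^ 2 * (1 - v) - (2 * α - 1) * (1 - w)) ≤ α * (w - v) := by
    set L := α + (1 - α) * v with hL
    have hLpos : 0 < L := by rw [hL]; nlinarith
    have h1 : 0 ≤ L * (α * (w - v) - v * (α ^ 2 * (1 - v) - (2 * α - 1) * (1 - w))) := by
      have e : L * (α * (w - v) - v * (α ^ 2 * (1 - v) - (2 * α - 1) * (1 - w)))
          = (w * L - v) * (α - (2 * α - 1) * v) + v * (α ^ 2 * (1 - α) * (1 - v) ^ 2) := by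
        rw [hL]; ring
      rw [e]
      have : 0 ≤ α - (2 * α - 1) * v := by nlinarith
      have h3 : 0 ≤ v * (α ^ 2 * (1 - α) * (1 - v) ^ 2) := by
        have : 0 ≤ 1 - α := by linarith
        positivity
      have h4 : 0 ≤ w * L - v := by linarith
      positivity
    have := nonneg_of_mul_nonneg_right h1 hLpos
    linarith
  have e1 : yh / K * (q * (1 - v) - K * (1 - w)) = yh / K * q * (1 - v) - yh * (1 - w) := by
    field_simp
  rw [e1]
  have h2 : yh / K * q * (1 - v) - yh * (1 - w)
      ≤ xh * (α ^ 2 * (1 - v) - (2 * α - 1) * (1 - w)) := by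
    have : yh / K * q * (1 - v) ≤ α ^ 2 * xh * (1 - v) := by
      apply mul_le_mul_of_nonneg_right hJL; linarith
    rw [hα] at this ⊢
    nlinarith
  have h3 : α ^ 2 * (1 - v) - (2 * α - 1) * (1 - w) ≤ α * (w / v - 1) := by
    have : α * (w / v - 1) = (α * (w - v)) / v := by field_simp
    rw [this, le_div_iff₀ hv0]; linarith
  have h4 : 0 < α * (q * yh * (1 - v) * (w / v - 1)) := by
    have : 0 < w / v - 1 := by rw [sub_pos, lt_div_iff₀ hv0]; linarith
    have : 0 < 1 - v := by linarith
    have : 0 < q := by linarith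
    positivity
  have h5 := mul_le_mul_of_nonneg_left h3 hxh.le
  calc _ ≤ xh * (α * (w / v - 1)) := h2.trans h5
    _ < xh * (α * (w / v - 1)) + α * (q * yh * (1 - v) * (w / v - 1)) := by linarith
    _ = _ := by ring

lemma aux_core {q K yh xh α : ℝ} (hK : 0 < K) (hqK : K < q) (hxh : 0 < xh) (hyh : 0 < yh)
    (hα1 : α < 1) (hα : yh = (2 * α - 1) * xh) (hJL : yh / K * q ≤ α ^ 2 * xh)
    (v w : ℝ → ℝ)
    (hv : ∀ t, HasDerivAt v ((xh + q * yh * (1 - v t)) * (w t - v t)) t)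
    (hw : ∀ t, HasDerivAt w (w t * (yh / K * (q * (1 - v t) - K * (1 - w t)))) t)
    (hxpos : ∀ t, 0 < xh + q * yh * (1 - v t)) (hwpos : ∀ t, 0 < w t)
    (hv0 : Tendsto v atBot (nhds 0)) :
    (∀ t, 0 < v t) ∧ (∀ t, v t < 1 → w t ≤ v t ^ α) ∧ (∀ t, v t < 1) ∧ ∀ t, v t < w t := by
  have hα0 : 1 / 2 < α := by
    by_contra h
    have : (2 * α - 1) * xh ≤ 0 := mul_nonpos_of_nonpos_of_nonneg (by linarith) hxh.le
    linarith
  have hq : 0 < q := by linarith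
  have hvc : Continuous v := continuous_iff_continuousAt.2 fun t => (hv t).continuousAt
  have hwc : Continuous w := continuous_iff_continuousAt.2 fun t => (hw t).continuousAt
  have hvpos : ∀ t, 0 < v t := by
    intro t0
    by_contra hcon
    have hcon : v t0 ≤ 0 := not_lt.1 hcon
    have hle : ∀ t, t ≤ t0 → v t ≤ 0 := by
      intro t ht
      by_contra h
      obtain ⟨c, hc1, hc2, hc3, hc4⟩ := aux_first hvc ht (not_le.1 h) hcon
      have := aux_deriv_nonpos hc1 (hv c) hc4 hc3
      have h2 : 0 < (xh + q * yh * (1 - v c)) * (w c - v c) :=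
        mul_pos (hxpos c) (by linarith [hwpos c])
      linarith
    have hmono : StrictMonoOn v (Iic t0) := by
      apply strictMonoOn_of_deriv_pos (convex_Iic t0) hvc.continuousOn
      intro t ht
      rw [interior_Iic] at ht
      rw [(hv t).deriv]
      exact mul_pos (hxpos t) (by linarith [hwpos t, hle t ht.le])
    have h1 : v (t0 - 1) < 0 := by
      have := hmono (show t0 - 1 ∈ Iic t0 by simp) (show t0 ∈ Iic t0 by simp) (by linarith)
      linarith
    have h2 : (0:ℝ) ≤ v (t0 - 1) := by
      refine le_of_tendsto hv0 ?_
      filter_upwards [eventually_le_atBot (t0 - 1)] with t ht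
      exact hmono.monotoneOn (show t ∈ Iic t0 by simp; linarith)
        (show t0 - 1 ∈ Iic t0 by simp) ht
    linarith
  have hbar : ∀ t, v t < 1 → w t ≤ v t ^ α := by
    intro t0 hvt0
    by_contra hcon
    have hcon : v t0 ^ α < w t0 := not_le.1 hcon
    let F : ℝ → ℝ := fun t => Real.log (w t) - α * Real.log (v t)
    have hFd : ∀ t, HasDerivAt F ((w t * (yh / K * (q * (1 - v t) - K * (1 - w t)))) / w t
        - α * (((xh + q * yh * (1 - v t)) * (w t - v t)) / v t)) t := fun t =>
      ((hw t).log (hwpos t).ne').sub (((hv t).log (hvpos t).ne').const_mul α)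
    have hFc : Continuous F := continuous_iff_continuousAt.2 fun t => (hFd t).continuousAt
    have hFiff : ∀ t, 0 < F t ↔ v t ^ α < w t := by
      intro t
      simp only [F]
      rw [sub_pos, ← Real.log_rpow (hvpos t),
        Real.log_lt_log_iff (rpow_pos_of_pos (hvpos t) _) (hwpos t)]
    have hrel : ∀ t, v t < 1 → v t < v t ^ α := by
      intro t ht
      conv_lhs => rw [← rpow_one (v t)]
      exact rpow_lt_rpow_of_exponent_gt (hvpos t) ht hα1
    let G : ℝ → ℝ := fun t => min (F t) (1 - v t)
    have hGc : Continuous G := hFc.min (by fun_prop)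
    have hG : ∀ t, t ≤ t0 → 0 < G t := by
      intro t ht
      by_contra h
      obtain ⟨c, hc1, hc2, hc3, hc4⟩ := aux_last hGc ht
        (lt_min ((hFiff t0).2 hcon) (by linarith)) (not_lt.1 h)
      have hmono : StrictMonoOn v (Icc c t0) := by
        apply strictMonoOn_of_deriv_pos (convex_Icc _ _) hvc.continuousOn
        intro t ht
        rw [interior_Icc] at ht
        rw [(hv t).deriv]
        have := hc4 t ht.1 ht.2.le
        have h1 := (hFiff t).1 (lt_min_iff.1 this).1
        have h2 := hrel t (by linarith [(lt_min_iff.1 this).2])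
        exact mul_pos (hxpos t) (by linarith)
      have hvc1 : v c < 1 := by
        have := hmono (left_mem_Icc.2 hc2.le) (right_mem_Icc.2 hc2.le) hc2
        linarith
      have hFc0 : F c ≤ 0 := by
        rcases min_le_iff.1 hc3 with h | h
        · exact h
        · linarith
      have hFc1 : 0 ≤ F c := by
        have : Tendsto F (nhdsWithin c (Ioi c)) (nhds (F c)) :=
          (hFc.tendsto c).mono_left nhdsWithin_le_nhds
        refine ge_of_tendsto this ?_
        filter_upwards [Ioo_mem_nhdsGT hc2] with t ht
        exact (lt_min_iff.1 (hc4 t ht.1 ht.2.le)).1.le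
      have hd := aux_deriv_nonneg hc2 (hFd c)
        (fun t h1 h2 => (lt_min_iff.1 (hc4 t h1 h2)).1) hFc0
      have hwc' : w c = v c ^ α := by
        have : Real.log (w c) = Real.log (v c ^ α) := by
          rw [Real.log_rpow (hvpos c)]
          have : F c = 0 := le_antisymm hFc0 hFc1
          simp only [F] at this
          linarith
        exact Real.log_injOn_pos (hwpos c) (rpow_pos_of_pos (hvpos c) _) this
      have hb := aux_barrier hK hqK hxh hyh hα1 hα hJL (hvpos c) hvc1
      rw [← hwc'] at hb
      have e1 : (w c * (yh / K * (q * (1 - v c) - K * (1 - w c)))) / w c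
          = yh / K * (q * (1 - v c) - K * (1 - w c)) := by
        rw [mul_div_cancel_left₀ _ (hwpos c).ne']
      have e2 : ((xh + q * yh * (1 - v c)) * (w c - v c)) / v c
          = (xh + q * yh * (1 - v c)) * (w c / v c - 1) := by
        have := (hvpos c).ne'
        field_simp
      rw [e1, e2] at hd
      linarith
    have hG1 : ∀ t, t ≤ t0 → v t ^ α < w t := fun t ht => (hFiff t).1 (lt_min_iff.1 (hG t ht)).1
    have hG2 : ∀ t, t ≤ t0 → v t < 1 := fun t ht => by linarith [(lt_min_iff.1 (hG t ht)).2]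
    have hmono : MonotoneOn v (Iic t0) := by
      apply (strictMonoOn_of_deriv_pos (convex_Iic t0) hvc.continuousOn _).monotoneOn
      intro t ht
      rw [interior_Iic] at ht
      rw [(hv t).deriv]
      have := hG1 t ht.le
      have := hrel t (hG2 t ht.le)
      exact mul_pos (hxpos t) (by linarith)
    let z : ℝ → ℝ := fun t => v t ^ (1 - α)
    have hzd : ∀ t, HasDerivAt z (((xh + q * yh * (1 - v t)) * (w t - v t)) * (1 - α)
        * v t ^ ((1 - α) - 1)) t := fun t => (hv t).rpow_const (Or.inl (hvpos t).ne')
    have hzc : Continuous z := continuous_iff_continuousAt.2 fun t => (hzd t).continuousAt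
    set c : ℝ := xh * (1 - α) * (1 - z t0) with hcdef
    have hz1 : z t0 < 1 := rpow_lt_one (hvpos t0).le hvt0 (by linarith)
    have hcpos : 0 < c := mul_pos (mul_pos hxh (by linarith)) (by linarith)
    have hder : ∀ t, t ≤ t0 → c ≤ ((xh + q * yh * (1 - v t)) * (w t - v t)) * (1 - α)
        * v t ^ ((1 - α) - 1) := by
      intro t ht
      have e : (1 - α) - 1 = -α := by ring
      rw [e]
      have hp : 0 < v t ^ (-α) := rpow_pos_of_pos (hvpos t) _
      have h1 : v t ^ α * v t ^ (-α) = 1 := by rw [← rpow_add (hvpos t)]; simp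
      have h2 : v t * v t ^ (-α) = z t := by
        simp only [z]
        rw [sub_eq_add_neg, rpow_add (hvpos t), rpow_one]
      have h3 : z t ≤ z t0 := by
        apply rpow_le_rpow (hvpos t).le (hmono ht (le_refl t0) ht) (by linarith)
      have h4 : 1 - z t0 ≤ (w t - v t) * v t ^ (-α) := by
        have := mul_le_mul_of_nonneg_right (hG1 t ht).le hp.le
        nlinarith
      have h5 : xh ≤ xh + q * yh * (1 - v t) := by
        have : 0 < 1 - v t := by linarith [hG2 t ht]
        have : 0 < q * yh * (1 - v t) := by positivity
        linarith
      have h6 : xh * (1 - z t0) ≤ (xh + q * yh * (1 - v t)) * ((w t - v t) * v t ^ (-α)) :=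
        mul_le_mul h5 h4 (by linarith) (hxpos t).le
      have h7 := mul_le_mul_of_nonneg_right h6 (show 0 ≤ 1 - α by linarith)
      rw [hcdef]
      linarith
    have hzm : MonotoneOn (fun t => z t - c * t) (Iic t0) := by
      have hd : ∀ t, HasDerivAt (fun t => z t - c * t) (_ - c * 1) t := fun t =>
        (hzd t).sub ((hasDerivAt_id t).const_mul c)
      apply monotoneOn_of_deriv_nonneg (convex_Iic t0)
      · exact (hzc.sub (by fun_prop)).continuousOn
      · intro t ht
        exact (hd t).differentiableAt.differentiableWithinAt
      · intro t ht
        rw [interior_Iic] at ht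
        rw [(hd t).deriv]
        linarith [hder t (le_of_lt ht)]
    have hlt : t0 - 1 / c ≤ t0 := by
      have : 0 < 1 / c := by positivity
      linarith
    have h9 := hzm (show t0 - 1 / c ∈ Iic t0 from hlt) (show t0 ∈ Iic t0 from le_refl t0) hlt
    simp only at h9
    have h10 : c * (t0 - 1 / c) = c * t0 - 1 := by field_simp
    rw [h10] at h9
    have h11 : 0 < z (t0 - 1 / c) := rpow_pos_of_pos (hvpos _) _
    linarith
  let D : ℝ → ℝ := fun t => w t - v t
  have hDd : ∀ t, HasDerivAt D (w t * (yh / K * (q * (1 - v t) - K * (1 - w t))) -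
      (xh + q * yh * (1 - v t)) * (w t - v t)) t := fun t => (hw t).sub (hv t)
  have hDc : Continuous D := hwc.sub hvc
  -- the diagonal is crossed upwards
  have hdiag : ∀ a c, a < c → v c < 1 → D c ≤ 0 → (∀ t, a ≤ t → t < c → 0 < D t) → False := by
    intro a c hac hvc1 hDc0 hpos
    have hge : 0 ≤ D c := by
      have : Tendsto D (nhdsWithin c (Iio c)) (nhds (D c)) :=
        (hDc.tendsto c).mono_left nhdsWithin_le_nhds
      refine ge_of_tendsto this ?_
      filter_upwards [Ioo_mem_nhdsLT hac] with t ht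
      exact (hpos t ht.1.le ht.2).le
    have heq : w c = v c := by
      have : D c = 0 := le_antisymm hDc0 hge
      simp only [D] at this
      linarith
    have := aux_deriv_nonpos hac (hDd c) hpos hDc0
    rw [heq] at this
    have h2 : 0 < v c * (yh / K * ((q - K) * (1 - v c))) := by
      have := hvpos c
      have : 0 < 1 - v c := by linarith
      have : 0 < q - K := by linarith
      positivity
    nlinarith
  obtain ⟨T, hT⟩ := eventually_atBot.1 (hv0.eventually_lt_const (show (0:ℝ) < 1 by norm_num))
  have hDT : ∀ t, t ≤ T → 0 < D t := by
    intro t0 ht0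
    by_contra hcon
    have hcon : D t0 ≤ 0 := not_lt.1 hcon
    have hle : ∀ t, t ≤ t0 → D t ≤ 0 := by
      intro t ht
      by_contra h
      obtain ⟨c, hc1, hc2, hc3, hc4⟩ := aux_first hDc ht (not_le.1 h) hcon
      exact hdiag t c hc1 (hT c (hc2.trans ht0)) hc3 hc4
    have hanti : AntitoneOn v (Iic t0) := by
      apply antitoneOn_of_deriv_nonpos (convex_Iic t0) hvc.continuousOn
      · intro t ht
        exact (hv t).differentiableAt.differentiableWithinAt
      · intro t ht
        rw [interior_Iic] at ht
        rw [(hv t).deriv]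
        exact mul_nonpos_of_nonneg_of_nonpos (hxpos t).le (hle t (le_of_lt ht))
    have : v t0 ≤ 0 := by
      refine ge_of_tendsto hv0 ?_
      filter_upwards [eventually_le_atBot t0] with t ht
      exact hanti ht (le_refl t0) ht
    linarith [hvpos t0]
  have hall : ∀ t, 0 < min (D t) (1 - v t) := by
    intro t1
    rcases le_total t1 T with h | h
    · exact lt_min (hDT t1 h) (by linarith [hT t1 h])
    by_contra hcon
    obtain ⟨c, hc1, hc2, hc3, hc4⟩ := aux_first (f := fun t => min (D t) (1 - v t))
      (hDc.min (by fun_prop)) h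
      (lt_min (hDT T le_rfl) (by linarith [hT T le_rfl])) (not_lt.1 hcon)
    have hvc1 : v c < 1 := by
      set N := xh + q * yh with hN
      have hd : ∀ t, HasDerivAt (fun t => (1 - v t) * Real.exp (N * t))
          ((0 - (xh + q * yh * (1 - v t)) * (w t - v t)) * Real.exp (N * t)
            + (1 - v t) * (Real.exp (N * t) * (N * 1))) t := fun t =>
        ((hasDerivAt_const t 1).sub (hv t)).mul (((hasDerivAt_id t).const_mul N).exp)
      have hm : MonotoneOn (fun t => (1 - v t) * Real.exp (N * t)) (Icc T c) := by
        apply monotoneOn_of_deriv_nonneg (convex_Icc _ _)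
        · fun_prop
        · intro t ht
          exact (hd t).differentiableAt.differentiableWithinAt
        · intro t ht
          rw [interior_Icc] at ht
          rw [(hd t).deriv]
          have hp := lt_min_iff.1 (hc4 t ht.1.le ht.2)
          have hv1 : v t < 1 := by linarith [hp.2]
          have hw1 : w t ≤ 1 := (hbar t hv1).trans
            (rpow_le_one (hvpos t).le hv1.le (by linarith))
          have hx1 : xh + q * yh * (1 - v t) ≤ N := by
            have : 0 < q * yh * v t := by have := hvpos t; positivity
            rw [hN]; linarith
          have : (xh + q * yh * (1 - v t)) * (w t - v t) ≤ N * (1 - v t) :=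
            mul_le_mul hx1 (by linarith) hp.1.le ((hxpos t).le.trans hx1)
          have he := Real.exp_pos (N * t)
          nlinarith
      have := hm (left_mem_Icc.2 hc1.le) (right_mem_Icc.2 hc1.le) hc1.le
      simp only at this
      have h1 : 0 < (1 - v T) * Real.exp (N * T) :=
        mul_pos (by linarith [hT T le_rfl]) (Real.exp_pos _)
      have := pos_of_mul_pos_left (h1.trans_le this) (Real.exp_pos _).le
      linarith
    refine hdiag T c hc1 hvc1 ?_ (fun t h1 h2 => (lt_min_iff.1 (hc4 t h1 h2)).1)
    rcases min_le_iff.1 hc3 with h | h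
    · exact h
    · linarith
  refine ⟨hvpos, hbar, fun t => ?_, fun t => ?_⟩
  · linarith [(lt_min_iff.1 (hall t)).2]
  · have := (lt_min_iff.1 (hall t)).1
    simp only [D] at this
    linarith

set_option maxHeartbeats 1000000 in
lemma aux_param (n k : ℕ) (hk : 1 ≤ k) (hnk : 2 * k < n)
    (q σ : ℝ) (hq : (k : ℝ) < q) (hσ : 0 ≤ σ)
    (hn : 2 * (k : ℝ) + 8 + 4 * σ / k < n) (hqJL : qJL n k σ ≤ q) :
    2 * (k : ℝ) + σ < aSigma n k q σ ∧
    4 * aSigma n k q σ * (2 * (k : ℝ) + σ) * q ≤ k * (2 * (k : ℝ) + σ + aSigma n k q σ) ^ 2 := by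
  have hK : (1:ℝ) ≤ k := by exact_mod_cast hk
  unfold qJL at hqJL
  unfold aSigma
  generalize (k : ℝ) = K at *
  generalize (n : ℝ) = m at *
  have hK0 : 0 < K := by linarith
  obtain ⟨M, hM⟩ : ∃ M, M = m - 2 * K := ⟨_, rfl⟩
  obtain ⟨s, hs⟩ : ∃ s, s = 2 * K + σ := ⟨_, rfl⟩
  obtain ⟨p, hp⟩ : ∃ p, p = q - K := ⟨_, rfl⟩
  have hs0 : 0 < s := by linarith
  have hp0 : 0 < p := by linarith
  have hMK : 4 * s < K * M := by
    have h1 : K * (2 * K + 8 + 4 * σ / K) < K * m := by gcongr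
    have h2 : K * (2 * K + 8 + 4 * σ / K) = 2 * K ^ 2 + 8 * K + 4 * σ := by field_simp
    rw [h2] at h1
    rw [hs, hM]; nlinarith
  have hM0 : 0 < M := by
    by_contra h
    nlinarith
  have hrad : K * (2 * K + σ) * ((K + 1) * m - K * (2 - σ)) = K * s * ((K + 1) * M + K * s) := by
    rw [hs, hM]; ring
  rw [hrad] at hqJL
  set Δ := Real.sqrt (K * s * ((K + 1) * M + K * s)) with hΔ
  have hΔ0 : 0 ≤ Δ := Real.sqrt_nonneg _
  have hΔ2 : Δ ^ 2 = K * s * ((K + 1) * M + K * s) := Real.sq_sqrt (by positivity)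
  obtain ⟨A, hA⟩ : ∃ A, A = K * ((K + 1) * M - 2 * s) := ⟨_, rfl⟩
  have hA0 : 0 < A := by
    rw [hA]; apply mul_pos hK0; nlinarith
  have hC : A ^ 2 - (2 * Δ) ^ 2 = K * (K + 1) ^ 2 * M * (K * M - 4 * s) := by
    rw [mul_pow, hΔ2, hA]; ring
  have hAB : 0 < A - 2 * Δ := by
    have h1 : 0 < A ^ 2 - (2 * Δ) ^ 2 := by
      rw [hC]
      have : 0 < K * M - 4 * s := by linarith
      positivity
    have h2 : 2 * Δ < A := lt_of_pow_lt_pow_left₀ 2 hA0.le (by linarith)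
    linarith
  have hden : K * (K + 1) * m - 2 * K ^ 2 * (K + 3) - 2 * K * σ - 2 * Δ = A - 2 * Δ := by
    rw [hA, hs, hM]; ring
  have hnum : K * (K + 1) * m - K ^ 2 * (2 - σ) + 2 * K + σ - 2 * Δ
      = A - 2 * Δ + (K + 1) ^ 2 * s := by
    rw [hA, hs, hM]; ring
  rw [hden, hnum, ← mul_div_assoc, div_le_iff₀ hAB] at hqJL
  have hpA : K * (K + 1) ^ 2 * s ≤ p * (A - 2 * Δ) := by
    rw [hp]; nlinarith
  have ha : q * (m - 2 * K) - (m + σ) * K = p * M - K * s := by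
    rw [hp, hM, hs]; ring
  rw [ha, ← hs]
  constructor
  · have h1 : K * (K + 1) ^ 2 * s ≤ p * A := by nlinarith
    rw [hA] at h1
    have h2 : K * (K + 1) * ((K + 1) * s) < K * (K + 1) * (p * M) := by
      have : 0 < K * p * s := by positivity
      nlinarith
    have := lt_of_mul_lt_mul_left h2 (by positivity)
    linarith
  · have hq' : q = p + K := by linarith
    obtain ⟨e, he⟩ : ∃ e, e = K * (K + 1) ^ 2 * s := ⟨_, rfl⟩
    rw [← he] at hpA
    have h1 : 0 ≤ (A * p - e - 2 * Δ * p) * (A * p - e + 2 * Δ * p) := by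
      have : 0 ≤ Δ * p := by positivity
      have h3 : p * (A - 2 * Δ) = A * p - 2 * Δ * p := by ring
      rw [h3] at hpA
      apply mul_nonneg <;> linarith
    have h2 : (A * p - e - 2 * Δ * p) * (A * p - e + 2 * Δ * p)
        = (K * (K + 1) ^ 2) * (K * (s + (p * M - K * s)) ^ 2
          - 4 * (p * M - K * s) * s * (p + K)) := by
      have : (A * p - e - 2 * Δ * p) * (A * p - e + 2 * Δ * p)
        = (A ^ 2 - (2 * Δ) ^ 2) * p ^ 2 - 2 * A * p * e + e ^ 2 := by ring
      rw [this, hC, he, hA]; ring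
    rw [h2] at h1
    have := nonneg_of_mul_nonneg_right h1 (by positivity)
    rw [hq']
    linarith

/-- for `n > 2k+8+4σ/k` and `q ≥ q_JL(k,σ)`, the positive orbit of the
Lotka–Volterra system connecting `(n+σ,0)` to `(x̂,ŷ)` stays below the curve `y = g(x)`
for `x ∈ (x̂, n+σ)`; in particular the orbit is the graph of a monotone function of `x`. -/
theorem orbit_below_barrier (n k : ℕ) (hk : 1 ≤ k) (hnk : 2 * k < n)
    (q σ : ℝ) (hq : (k : ℝ) < q) (hσ : 0 ≤ σ)
    (hn : 2 * (k : ℝ) + 8 + 4 * σ / k < n) (hqJL : qJL n k σ ≤ q)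
    (x y : ℝ → ℝ)
    (hx : ∀ t, HasDerivAt x (x t * ((n : ℝ) + σ - x t - q * y t)) t)
    (hy : ∀ t, HasDerivAt y
      (y t * (-(((n : ℝ) - 2 * k) / k) + x t / k + y t)) t)
    (hxpos : ∀ t, 0 < x t) (hypos : ∀ t, 0 < y t)
    (hlimneg : Tendsto (fun t => (x t, y t)) atBot (nhds ((n : ℝ) + σ, 0)))
    (hlimpos : Tendsto (fun t => (x t, y t)) atTop
      (nhds (aSigma n k q σ / (q - (k : ℝ)), (2 * (k : ℝ) + σ) / (q - (k : ℝ))))) :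
    (∀ t : ℝ, aSigma n k q σ / (q - (k : ℝ)) < x t → x t < (n : ℝ) + σ →
      y t ≤ gFun n k q σ (x t)) ∧
    ∃ Y : ℝ → ℝ, (∀ t, y t = Y (x t)) ∧
      (MonotoneOn Y (Icc (aSigma n k q σ / (q - (k : ℝ))) ((n : ℝ) + σ)) ∨
       AntitoneOn Y (Icc (aSigma n k q σ / (q - (k : ℝ))) ((n : ℝ) + σ))) := by
  obtain ⟨has, hJL⟩ := aux_param n k hk hnk q σ hq hσ hn hqJL
  have hK : (1:ℝ) ≤ k := by exact_mod_cast hk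
  have hN : (n : ℝ) + σ = aSigma n k q σ / (q - k) + q * ((2 * (k : ℝ) + σ) / (q - k)) := by
    have : q - (k : ℝ) ≠ 0 := by linarith
    unfold aSigma
    field_simp
    ring
  have hb : ((n : ℝ) - 2 * k) =
      aSigma n k q σ / (q - k) + k * ((2 * (k : ℝ) + σ) / (q - k)) := by
    have : q - (k : ℝ) ≠ 0 := by linarith
    unfold aSigma
    field_simp
    ring
  have hα' : alphaExp n k q σ = (2 * (k : ℝ) + σ + aSigma n k q σ) / (2 * aSigma n k q σ) := rfl
  unfold gFun
  generalize alphaExp n k q σ = α at *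
  generalize aSigma n k q σ = a at *
  have hs0 : 0 < 2 * (k : ℝ) + σ := by linarith
  generalize 2 * (k : ℝ) + σ = s at *
  rw [hb] at hy
  rw [hN] at hx hlimneg ⊢
  clear hN hb hqJL hn hnk
  generalize (k : ℝ) = K at *
  have hp : 0 < q - K := by linarith
  have ha0 : 0 < a := by linarith
  have hα1 : α < 1 := by
    rw [hα', div_lt_one (by positivity)]; linarith
  have hα2 : s / (q - K) = (2 * α - 1) * (a / (q - K)) := by
    rw [hα']; field_simp; ring
  have hJL2 : s / (q - K) / K * q ≤ α ^ 2 * (a / (q - K)) := by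
    have e1 : s / (q - K) / K * q = (4 * a * s * q) / (4 * a * K * (q - K)) := by
      field_simp
    have e2 : α ^ 2 * (a / (q - K)) = (K * (s + a) ^ 2) / (4 * a * K * (q - K)) := by
      rw [hα']; field_simp; ring
    rw [e1, e2]
    exact div_le_div_of_nonneg_right hJL (by positivity)
  have hxh : 0 < a / (q - K) := by positivity
  have hyh : 0 < s / (q - K) := by positivity
  generalize a / (q - K) = xh at *
  generalize s / (q - K) = yh at *
  have hq0 : 0 < q := by linarith
  have hK0 : 0 < K := by linarith
  obtain ⟨v, hvdef⟩ : ∃ v : ℝ → ℝ, v = fun t => (xh + q * yh - x t) / (q * yh) := ⟨_, rfl⟩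
  obtain ⟨w, hwdef⟩ : ∃ w : ℝ → ℝ, w = fun t => y t / yh := ⟨_, rfl⟩
  have hxv : ∀ t, x t = xh + q * yh * (1 - v t) := by
    intro t; rw [hvdef]; field_simp; ring
  have hyw : ∀ t, y t = yh * w t := by
    intro t; rw [hwdef]; field_simp
  have hvd : ∀ t, HasDerivAt v ((xh + q * yh * (1 - v t)) * (w t - v t)) t := by
    intro t
    have h := ((hx t).const_sub (xh + q * yh)).div_const (q * yh)
    rw [← hvdef] at h
    refine h.congr_deriv ?_
    rw [hxv t, hyw t]; field_simp; ring
  have hwd : ∀ t, HasDerivAt w (w t * (yh / K * (q * (1 - v t) - K * (1 - w t)))) t := by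
    intro t
    have h := (hy t).div_const yh
    rw [← hwdef] at h
    refine h.congr_deriv ?_
    rw [hxv t, hyw t]; field_simp; ring
  have hwpos : ∀ t, 0 < w t := by
    intro t; rw [hwdef]; have := hypos t; positivity
  have hv0 : Tendsto v atBot (nhds 0) := by
    have h1 : Tendsto x atBot (nhds (xh + q * yh)) :=
      (continuous_fst.tendsto _).comp hlimneg
    have h2 := (h1.const_sub (xh + q * yh)).div_const (q * yh)
    rw [← hvdef] at h2
    simpa using h2
  obtain ⟨c1, c2, c3, c4⟩ := aux_core hK0 hq hxh hyh hα1 hα2 hJL2 v w hvd hwd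
    (fun t => by rw [← hxv]; exact hxpos t) hwpos hv0
  refine ⟨fun t _ _ => ?_, ?_⟩
  · have h := c2 t (c3 t)
    have e : xh + q * yh - x t = q * (yh * v t) := by rw [hxv t]; ring
    have hv := c1 t
    rw [e, mul_rpow hq0.le (by positivity), mul_rpow hyh.le hv.le, rpow_neg hq0.le,
      rpow_sub hyh, rpow_one, hyw t]
    have hqα : 0 < q ^ α := rpow_pos_of_pos hq0 _
    have hyα : 0 < yh ^ α := rpow_pos_of_pos hyh _
    have e2 : (q ^ α)⁻¹ * (yh / yh ^ α) * (q ^ α * (yh ^ α * v t ^ α)) = yh * v t ^ α := by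
      field_simp
    rw [e2]
    gcongr
  · have hxanti : StrictAnti x := by
      apply strictAnti_of_deriv_neg
      intro t
      rw [(hx t).deriv]
      apply mul_neg_of_pos_of_neg (hxpos t)
      have : xh + q * yh - x t - q * y t = -(q * yh * (w t - v t)) := by
        rw [hxv t, hyw t]; ring
      rw [this]
      have : 0 < w t - v t := by linarith [c4 t]
      have : 0 < q * yh * (w t - v t) := by positivity
      linarith
    have hwmono : StrictMono w := by
      apply strictMono_of_deriv_pos
      intro t
      rw [(hwd t).deriv]
      have h1 := hwpos t
      have h2 : 0 < q * (1 - v t) - K * (1 - w t) := by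
        nlinarith [c3 t, c4 t]
      positivity
    have hymono : Monotone y := by
      intro t1 t2 h
      rw [hyw, hyw]
      have := hwmono.monotone h
      gcongr
    have hbdd : ∀ t, y t ≤ yh := by
      have h1 : Tendsto y atTop (nhds yh) := (continuous_snd.tendsto _).comp hlimpos
      exact fun t => hymono.ge_of_tendsto h1 t
    refine ⟨fun ξ => sSup {r | ∃ t, ξ ≤ x t ∧ r = y t}, fun t => ?_, Or.inr ?_⟩
    · symm
      apply IsGreatest.csSup_eq
      refine ⟨⟨t, le_rfl, rfl⟩, ?_⟩
      rintro r ⟨t', h, rfl⟩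
      exact hymono (hxanti.le_iff_ge.1 h)
    · intro ξ1 _ ξ2 _ h12
      apply Real.sSup_le
      · rintro r ⟨t, ht, rfl⟩
        exact le_csSup ⟨yh, by rintro r ⟨t, _, rfl⟩; exact hbdd t⟩ ⟨t, h12.trans ht, rfl⟩
      · apply Real.sSup_nonneg
        rintro r ⟨t, _, rfl⟩
        exact (hypos t).le
end
end
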